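/- arXiv:2602.18271 — 8 statements merged into one kernel-verified Lean document; each statement's English description precedes it below -/
import Mathlib

section
/- For every γ₁ ∈ (0,1] and every γ₂ ∈ [0,1], setting γ = C(γ₁, γ₂), one has P(U ≤ γ₁, V ≤ γ₂) = P(W ≤ γ and U ≤ γ₁), where W is the two-stage FDR(H) aggregated p-value with threshold γ₁. (Lemma 1 of the paper.) -/
open MeasureTheory Set

/-- Lemma 1 of the paper: for every `γ₁ ∈ (0,1]` and `γ₂ ∈ [0,1]`, setting
`γ = C(γ₁, γ₂)`, one has `P(U ≤ γ₁, V ≤ γ₂) = P(W ≤ γ ∧ U ≤ γ₁)` where `W` is the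
two-stage FDR(H) aggregated p-value with threshold `γ₁`. -/
theorem two_stage_FDR_H_lemma1
    {Ω : Type*} [MeasurableSpace Ω] (P : Measure Ω) [IsProbabilityMeasure P]
    (U V : Ω → ℝ) (hU : Measurable U) (hV : Measurable V)
    (hUrange : ∀ ω, U ω ∈ Icc (0:ℝ) 1) (hVrange : ∀ ω, V ω ∈ Icc (0:ℝ) 1)
    (hUunif : ∀ t ∈ Icc (0:ℝ) 1, (P {ω | U ω ≤ t}).toReal = t)
    (hVatomless : ∀ v : ℝ, P {ω | V ω = v} = 0)
    (C : ℝ → ℝ → ℝ)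
    (hC : ∀ a b, C a b = (P {ω | U ω ≤ a ∧ V ω ≤ b}).toReal)
    (γ₁ : ℝ) (hγ₁ : γ₁ ∈ Ioc (0:ℝ) 1)
    (γ₂ : ℝ) (hγ₂ : γ₂ ∈ Icc (0:ℝ) 1)
    (W : Ω → ℝ) (hW : ∀ ω, W ω = if U ω ≤ γ₁ then C γ₁ (V ω) else U ω) :
    (P {ω | U ω ≤ γ₁ ∧ V ω ≤ γ₂}).toReal
      = (P {ω | W ω ≤ C γ₁ γ₂ ∧ U ω ≤ γ₁}).toReal := by
  have hA : MeasurableSet {ω | U ω ≤ γ₁} := measurableSet_le hU measurable_const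
  set μ : Measure ℝ := (P.restrict {ω | U ω ≤ γ₁}).map V with hμ
  haveI : IsFiniteMeasure μ := by rw [hμ]; infer_instance
  have hF : ∀ b, C γ₁ b = (μ (Iic b)).toReal := by
    intro b
    rw [hC, hμ, Measure.map_apply hV measurableSet_Iic,
      Measure.restrict_apply (hV measurableSet_Iic)]
    congr 2
    ext ω
    simp [and_comm]
  have hI : ∀ v, γ₂ < v → C γ₁ v ≤ C γ₁ γ₂ → μ (Ioc γ₂ v) = 0 := by
    intro v hv h
    rw [hF, hF, ENNReal.toReal_le_toReal (measure_ne_top _ _) (measure_ne_top _ _)] at h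
    have h1 : Ioc γ₂ v = Iic v \ Iic γ₂ := by
      ext x; simp [and_comm]
    rw [h1, measure_diff (Iic_subset_Iic.2 hv.le) measurableSet_Iic.nullMeasurableSet
      (measure_ne_top _ _)]
    exact tsub_eq_zero_of_le h
  have hT : μ {v | γ₂ < v ∧ C γ₁ v ≤ C γ₁ γ₂} = 0 := by
    refine measure_null_of_locally_null _ ?_
    intro x hx
    by_cases hmax : ∃ t, (γ₂ < t ∧ C γ₁ t ≤ C γ₁ γ₂) ∧ x < t
    · obtain ⟨t, ht, hxt⟩ := hmax
      refine ⟨Ioc γ₂ t, mem_nhdsWithin_of_mem_nhds (Ioc_mem_nhds hx.1 hxt), hI t ht.1 ht.2⟩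
    · push Not at hmax
      refine ⟨Ioc γ₂ x, Filter.mem_of_superset self_mem_nhdsWithin ?_, hI x hx.1 hx.2⟩
      intro y hy
      exact ⟨hy.1, hmax y hy⟩
  have hT' : P {ω | (γ₂ < V ω ∧ C γ₁ (V ω) ≤ C γ₁ γ₂) ∧ U ω ≤ γ₁} = 0 := by
    have h1 : (P.restrict {ω | U ω ≤ γ₁}) (V ⁻¹' {v | γ₂ < v ∧ C γ₁ v ≤ C γ₁ γ₂}) = 0 :=
      le_antisymm ((Measure.le_map_apply hV.aemeasurable _).trans hT.le) (zero_le)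
    rw [Measure.restrict_apply' hA] at h1
    exact h1
  congr 1
  apply le_antisymm
  · apply measure_mono
    rintro ω ⟨h1, h2⟩
    refine ⟨?_, h1⟩
    rw [hW, if_pos h1, hF, hF]
    exact ENNReal.toReal_mono (measure_ne_top _ _) (measure_mono (Iic_subset_Iic.2 h2))
  · calc P {ω | W ω ≤ C γ₁ γ₂ ∧ U ω ≤ γ₁}
        ≤ P ({ω | U ω ≤ γ₁ ∧ V ω ≤ γ₂} ∪
            {ω | (γ₂ < V ω ∧ C γ₁ (V ω) ≤ C γ₁ γ₂) ∧ U ω ≤ γ₁}) := by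
          apply measure_mono
          rintro ω ⟨h1, h2⟩
          rw [hW, if_pos h2] at h1
          rcases le_or_gt (V ω) γ₂ with h | h
          · exact Or.inl ⟨h2, h⟩
          · exact Or.inr ⟨⟨h, h1⟩, h2⟩
      _ ≤ _ := measure_union_le _ _
      _ = _ := by rw [hT', add_zero]
end

section
/- For every γ₁ ∈ (0,1], the two-stage FDR(H) aggregated p-value W with threshold γ₁ is uniformly distributed on [0,1]; that is, P(W ≤ γ) = γ for all γ ∈ [0,1]. (Theorem 1 of the paper: p_i^H(γ₁) follows the uniform distribution on (0,1) for any choice of γ₁ when the pair follows the null joint distribution.) -/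
open MeasureTheory Set

/-- Theorem 1 of the paper: for every `γ₁ ∈ (0,1]`, the two-stage FDR(H) aggregated
p-value `W` with threshold `γ₁` is uniformly distributed on `[0,1]`:
`P(W ≤ γ) = γ` for all `γ ∈ [0,1]`. -/
theorem two_stage_FDR_H_uniform
    {Ω : Type*} [MeasurableSpace Ω] (P : Measure Ω) [IsProbabilityMeasure P]
    (U V : Ω → ℝ) (hU : Measurable U) (hV : Measurable V)
    (hUrange : ∀ ω, U ω ∈ Icc (0:ℝ) 1) (hVrange : ∀ ω, V ω ∈ Icc (0:ℝ) 1)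
    (hUunif : ∀ t ∈ Icc (0:ℝ) 1, (P {ω | U ω ≤ t}).toReal = t)
    (hVatomless : ∀ v : ℝ, P {ω | V ω = v} = 0)
    (C : ℝ → ℝ → ℝ)
    (hC : ∀ a b, C a b = (P {ω | U ω ≤ a ∧ V ω ≤ b}).toReal)
    (γ₁ : ℝ) (hγ₁ : γ₁ ∈ Ioc (0:ℝ) 1)
    (W : Ω → ℝ) (hW : ∀ ω, W ω = if U ω ≤ γ₁ then C γ₁ (V ω) else U ω) :
    ∀ γ ∈ Icc (0:ℝ) 1, (P {ω | W ω ≤ γ}).toReal = γ := by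
  intro γ hγ
  have hg1 : (P {ω | U ω ≤ γ₁}).toReal = γ₁ := hUunif γ₁ ⟨hγ₁.1.le, hγ₁.2⟩
  have hle : ∀ b, C γ₁ b ≤ γ₁ := by
    intro b
    rw [hC]
    conv_rhs => rw [← hg1]
    exact ENNReal.toReal_mono (measure_ne_top _ _) (measure_mono fun ω h => h.1)
  rcases le_or_gt γ₁ γ with h | h
  · have : {ω | W ω ≤ γ} = {ω | U ω ≤ γ} := by
      ext ω
      simp only [mem_ofPred_eq, hW]
      split_ifs with h1
      · exact ⟨fun _ => h1.trans h, fun _ => (hle _).trans h⟩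
      · rfl
    rw [this]
    exact hUunif γ hγ
  · have hAm : MeasurableSet {ω | U ω ≤ γ₁} := measurableSet_le hU measurable_const
    let μ : Measure ℝ := (P.restrict {ω | U ω ≤ γ₁}).map V
    have hμ : ∀ s, MeasurableSet s → μ s = P {ω | U ω ≤ γ₁ ∧ V ω ∈ s} := by
      intro s hs
      rw [Measure.map_apply hV hs, Measure.restrict_apply (hV hs)]
      congr 1
      ext ω
      simp [and_comm]
    have hfin : IsFiniteMeasure μ := by
      constructor
      rw [hμ _ MeasurableSet.univ]
      exact measure_lt_top _ _
    have hna : NullSingletonClass μ := by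
      constructor
      intro v
      rw [hμ _ (measurableSet_singleton v)]
      exact measure_mono_null (fun ω h => h.2) (hVatomless v)
    have hF : ∀ b, C γ₁ b = (μ (Iic b)).toReal := by
      intro b
      rw [hC, hμ _ measurableSet_Iic]
      rfl
    have hmono : Monotone (C γ₁) := by
      intro a b hab
      rw [hF, hF]
      exact ENNReal.toReal_mono (measure_ne_top _ _) (measure_mono (Iic_subset_Iic.2 hab))
    have hcont : Continuous (C γ₁) := by
      have h1 : Continuous fun b => ∫ x in (0:ℝ)..b, (1:ℝ) ∂μ :=
        intervalIntegral.continuous_primitive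
          (fun a b => (integrable_const (1:ℝ)).intervalIntegrable) 0
      have h2 : C γ₁ = fun b => C γ₁ 0 + ∫ x in (0:ℝ)..b, (1:ℝ) ∂μ := by
        funext b
        rw [← intervalIntegral.integral_Iic_sub_Iic (integrable_const (1:ℝ)).integrableOn
          (integrable_const (1:ℝ)).integrableOn, hF, hF]
        simp [Measure.real]
      rw [h2]
      exact continuous_const.add h1
    have h0 : C γ₁ 0 = 0 := by
      rw [hC]
      have : P {ω | U ω ≤ γ₁ ∧ V ω ≤ 0} = 0 :=
        measure_mono_null (fun ω h => le_antisymm h.2 (hVrange ω).1) (hVatomless 0)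
      simp [this]
    have h1 : C γ₁ 1 = γ₁ := by
      rw [hC]
      conv_rhs => rw [← hg1]
      congr 2
      ext ω
      simp [(hVrange ω).2]
    obtain ⟨v, -, hv⟩ := intermediate_value_Icc (zero_le_one' ℝ) hcont.continuousOn
      (show γ ∈ Icc (C γ₁ 0) (C γ₁ 1) by rw [h0, h1]; exact ⟨hγ.1, h.le⟩)
    let S : Set ℝ := {b | C γ₁ b ≤ γ}
    have hSne : S.Nonempty := ⟨v, hv.le⟩
    have hSb : BddAbove S := by
      refine ⟨1, fun b hb => ?_⟩
      by_contra hlt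
      have := hmono (not_le.1 hlt).le
      have hb' : C γ₁ b ≤ γ := hb
      linarith
    have hSc : IsClosed S := isClosed_le hcont continuous_const
    have hs : sSup S ∈ S := hSc.csSup_mem hSne hSb
    have hs' : C γ₁ (sSup S) = γ :=
      le_antisymm hs (hv ▸ hmono (le_csSup hSb hv.le))
    have : {ω | W ω ≤ γ} = {ω | U ω ≤ γ₁ ∧ V ω ≤ sSup S} := by
      ext ω
      simp only [mem_ofPred_eq, hW]
      split_ifs with h2
      · exact ⟨fun h3 => ⟨h2, le_csSup hSb h3⟩, fun h3 => (hmono h3.2).trans hs⟩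
      · exact ⟨fun h3 => absurd (h3.trans h.le) h2, fun h3 => absurd h3.1 h2⟩
    rw [this, ← hC, hs']
end

section
/- Let γ₁ ∈ (0,1] and let γ satisfy γ₁ ≤ γ ≤ 1. Then the event {W ≤ γ} equals the event {U ≤ γ} exactly as sets, and consequently P(W ≤ γ) = γ. (The case γ ≥ γ₁ in the proof of Theorem 1: since C(γ₁, v) ≤ γ₁ for all v, every ω with U(ω) ≤ γ₁ has W(ω) ≤ γ₁ ≤ γ, and on {U > γ₁} one has W = U.) -/
open MeasureTheory Set

/-- The case `γ ≥ γ₁` in the proof of Theorem 1: for `γ₁ ≤ γ ≤ 1`, the event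
`{W ≤ γ}` equals the event `{U ≤ γ}` exactly as sets, and consequently
`P(W ≤ γ) = γ`. -/
theorem two_stage_FDR_H_case_ge
    {Ω : Type*} [MeasurableSpace Ω] (P : Measure Ω) [IsProbabilityMeasure P]
    (U V : Ω → ℝ) (hU : Measurable U) (hV : Measurable V)
    (hUrange : ∀ ω, U ω ∈ Icc (0:ℝ) 1) (hVrange : ∀ ω, V ω ∈ Icc (0:ℝ) 1)
    (hUunif : ∀ t ∈ Icc (0:ℝ) 1, (P {ω | U ω ≤ t}).toReal = t)
    (hVatomless : ∀ v : ℝ, P {ω | V ω = v} = 0)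
    (C : ℝ → ℝ → ℝ)
    (hC : ∀ a b, C a b = (P {ω | U ω ≤ a ∧ V ω ≤ b}).toReal)
    (γ₁ : ℝ) (hγ₁ : γ₁ ∈ Ioc (0:ℝ) 1)
    (W : Ω → ℝ) (hW : ∀ ω, W ω = if U ω ≤ γ₁ then C γ₁ (V ω) else U ω)
    (γ : ℝ) (hγl : γ₁ ≤ γ) (hγu : γ ≤ 1) :
    {ω | W ω ≤ γ} = {ω | U ω ≤ γ} ∧ (P {ω | W ω ≤ γ}).toReal = γ := by
  have hCle : ∀ v, C γ₁ v ≤ γ₁ := by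
    intro v
    rw [hC]
    calc (P {ω | U ω ≤ γ₁ ∧ V ω ≤ v}).toReal ≤ (P {ω | U ω ≤ γ₁}).toReal :=
          ENNReal.toReal_mono (measure_ne_top P _) (measure_mono (fun ω h => h.1))
      _ = γ₁ := hUunif γ₁ ⟨hγ₁.1.le, hγ₁.2⟩
  have hset : {ω | W ω ≤ γ} = {ω | U ω ≤ γ} := by
    ext ω
    simp only [mem_setOf_eq]
    rw [hW]
    split_ifs with h
    · exact ⟨fun _ => h.trans hγl, fun _ => (hCle _).trans hγl⟩
    · exact Iff.rfl
  refine ⟨hset, ?_⟩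
  rw [hset]
  exact hUunif γ ⟨hγ₁.1.le.trans hγl, hγu⟩
end

section
/- Let γ₁ ∈ (0,1] and let γ satisfy 0 ≤ γ < γ₁. Then P(W ≤ γ) = P(U ≤ γ₁ and C(γ₁, V) ≤ γ) = γ. (The case γ < γ₁ in the proof of Theorem 1.) -/
open MeasureTheory Set

/-- The case `γ < γ₁` in the proof of Theorem 1: for `0 ≤ γ < γ₁`,
`P(W ≤ γ) = P(U ≤ γ₁ ∧ C(γ₁, V) ≤ γ) = γ`. -/
theorem two_stage_FDR_H_case_lt
    {Ω : Type*} [MeasurableSpace Ω] (P : Measure Ω) [IsProbabilityMeasure P]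
    (U V : Ω → ℝ) (hU : Measurable U) (hV : Measurable V)
    (hUrange : ∀ ω, U ω ∈ Icc (0:ℝ) 1) (hVrange : ∀ ω, V ω ∈ Icc (0:ℝ) 1)
    (hUunif : ∀ t ∈ Icc (0:ℝ) 1, (P {ω | U ω ≤ t}).toReal = t)
    (hVatomless : ∀ v : ℝ, P {ω | V ω = v} = 0)
    (C : ℝ → ℝ → ℝ)
    (hC : ∀ a b, C a b = (P {ω | U ω ≤ a ∧ V ω ≤ b}).toReal)
    (γ₁ : ℝ) (hγ₁ : γ₁ ∈ Ioc (0:ℝ) 1)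
    (W : Ω → ℝ) (hW : ∀ ω, W ω = if U ω ≤ γ₁ then C γ₁ (V ω) else U ω)
    (γ : ℝ) (hγl : 0 ≤ γ) (hγu : γ < γ₁) :
    (P {ω | W ω ≤ γ}).toReal
        = (P {ω | U ω ≤ γ₁ ∧ C γ₁ (V ω) ≤ γ}).toReal
      ∧ (P {ω | W ω ≤ γ}).toReal = γ := by
  have hm : MeasurableSet {ω | U ω ≤ γ₁} := measurableSet_le hU measurable_const
  have hset : {ω | W ω ≤ γ} = {ω | U ω ≤ γ₁ ∧ C γ₁ (V ω) ≤ γ} := by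
    ext ω
    simp only [mem_ofPred_eq, hW ω]
    split_ifs with h
    · simp [h]
    · simp only [h, false_and, iff_false, not_le]
      linarith [not_le.mp h]
  rw [hset]
  refine ⟨rfl, ?_⟩
  set ν : Measure ℝ := (P.restrict {ω | U ω ≤ γ₁}).map V with hν
  have hνapp : ∀ s, MeasurableSet s → ν s = P {ω | U ω ≤ γ₁ ∧ V ω ∈ s} := by
    intro s hs
    rw [hν, Measure.map_apply hV hs, Measure.restrict_apply (hV hs)]
    congr 1
    ext ω
    simp [and_comm]
  have hna : NullSingletonClass ν := ⟨fun v => by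
    rw [hνapp _ (measurableSet_singleton v)]
    exact measure_mono_null (fun ω h => h.2) (hVatomless v)⟩
  have hfin : IsFiniteMeasure ν := by rw [hν]; infer_instance
  have hF : ∀ b, C γ₁ b = ν.real (Iic b) := by
    intro b
    rw [hC, Measure.real, hνapp _ measurableSet_Iic]
    rfl
  have hcont : Continuous (C γ₁) := by
    have h1 : C γ₁ = fun b => C γ₁ 0 + ∫ x in (0:ℝ)..b, (1:ℝ) ∂ν := by
      funext b
      rw [← intervalIntegral.integral_Iic_sub_Iic (integrable_const _).integrableOn
        (integrable_const _).integrableOn]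
      simp [hF]
    rw [h1]
    exact continuous_const.add (intervalIntegral.continuous_primitive
      (fun a b => intervalIntegrable_const) 0)
  have hmono : Monotone (C γ₁) := by
    intro a b hab
    rw [hF, hF]
    exact measureReal_mono (Iic_subset_Iic.mpr hab)
  have h0 : C γ₁ 0 = 0 := by
    rw [hC]
    have : P {ω | U ω ≤ γ₁ ∧ V ω ≤ 0} = 0 :=
      measure_mono_null (fun ω h => le_antisymm h.2 (hVrange ω).1) (hVatomless 0)
    rw [this]; rfl
  have h1 : C γ₁ 1 = γ₁ := by
    rw [hC]
    have : {ω | U ω ≤ γ₁ ∧ V ω ≤ 1} = {ω | U ω ≤ γ₁} := by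
      ext ω
      simp [(hVrange ω).2]
    rw [this]
    exact hUunif γ₁ ⟨hγ₁.1.le, hγ₁.2⟩
  obtain ⟨b, hb, hbγ⟩ := intermediate_value_Icc (zero_le_one' ℝ) hcont.continuousOn
    (show γ ∈ Icc (C γ₁ 0) (C γ₁ 1) by rw [h0, h1]; exact ⟨hγl, hγu.le⟩)
  have hK : IsCompact (Icc (0:ℝ) 1 ∩ {v | C γ₁ v ≤ γ}) :=
    isCompact_Icc.inter_right (isClosed_le hcont continuous_const)
  obtain ⟨s, hs, hmax⟩ := hK.exists_isGreatest ⟨b, hb, hbγ.le⟩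
  have hsγ : C γ₁ s = γ := le_antisymm hs.2 (hbγ ▸ hmono (hmax ⟨hb, hbγ.le⟩))
  have hfinal : {ω | U ω ≤ γ₁ ∧ C γ₁ (V ω) ≤ γ} = {ω | U ω ≤ γ₁ ∧ V ω ≤ s} := by
    ext ω
    refine and_congr_right fun _ => ⟨fun h => hmax ⟨hVrange ω, h⟩, fun h => ?_⟩
    exact (hmono h).trans hsγ.le
  rw [hfinal, ← hC, hsγ]
end

section
/- Let γ₁ ∈ (0,1] and 0 ≤ γ < γ₁, and set t* = sup{t ∈ [0,1] : C(γ₁, t) ≤ γ}. Then C(γ₁, t*) = γ and the rejection region of the two-stage FDR(H) procedure is exactly the rectangle {W ≤ γ} = {U ≤ γ₁} ∩ {V ≤ t*}. (The rectangular form of the two-stage FDR(H) rejection region asserted in the paper's comparison of the two methods.) -/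
open MeasureTheory Set

/-- The rectangular form of the two-stage FDR(H) rejection region: for
`γ₁ ∈ (0,1]` and `0 ≤ γ < γ₁`, with `t* = sup {t ∈ [0,1] : C(γ₁, t) ≤ γ}`,
one has `C(γ₁, t*) = γ` and `{W ≤ γ} = {U ≤ γ₁} ∩ {V ≤ t*}`. -/
theorem two_stage_FDR_H_rejection_rectangle
    {Ω : Type*} [MeasurableSpace Ω] (P : Measure Ω) [IsProbabilityMeasure P]
    (U V : Ω → ℝ) (hU : Measurable U) (hV : Measurable V)
    (hUrange : ∀ ω, U ω ∈ Icc (0:ℝ) 1) (hVrange : ∀ ω, V ω ∈ Icc (0:ℝ) 1)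
    (hUunif : ∀ t ∈ Icc (0:ℝ) 1, (P {ω | U ω ≤ t}).toReal = t)
    (hVatomless : ∀ v : ℝ, P {ω | V ω = v} = 0)
    (C : ℝ → ℝ → ℝ)
    (hC : ∀ a b, C a b = (P {ω | U ω ≤ a ∧ V ω ≤ b}).toReal)
    (γ₁ : ℝ) (hγ₁ : γ₁ ∈ Ioc (0:ℝ) 1)
    (W : Ω → ℝ) (hW : ∀ ω, W ω = if U ω ≤ γ₁ then C γ₁ (V ω) else U ω)
    (γ : ℝ) (hγl : 0 ≤ γ) (hγu : γ < γ₁)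
    (tstar : ℝ) (htstar : tstar = sSup {t | t ∈ Icc (0:ℝ) 1 ∧ C γ₁ t ≤ γ}) :
    C γ₁ tstar = γ ∧ {ω | W ω ≤ γ} = {ω | U ω ≤ γ₁} ∩ {ω | V ω ≤ tstar} := by
  have hmono : Monotone (C γ₁) := by
    intro a b hab
    rw [hC, hC]
    refine ENNReal.toReal_mono (measure_ne_top _ _) (measure_mono ?_)
    rintro ω ⟨h1, h2⟩
    exact ⟨h1, h2.trans hab⟩
  have h0 : C γ₁ 0 = 0 := by
    rw [hC]
    have : P {ω | U ω ≤ γ₁ ∧ V ω ≤ 0} = 0 := by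
      refine measure_mono_null ?_ (hVatomless 0)
      rintro ω ⟨_, h2⟩
      exact le_antisymm h2 (hVrange ω).1
    rw [this]; rfl
  have h1 : C γ₁ 1 = γ₁ := by
    rw [hC, ← hUunif γ₁ ⟨hγ₁.1.le, hγ₁.2⟩]
    congr 2
    ext ω
    simp only [mem_ofPred_eq, hUunif γ₁ ⟨hγ₁.1.le, hγ₁.2⟩]
    exact ⟨fun h => h.1, fun h => ⟨h, (hVrange ω).2⟩⟩
  have hcont : ContinuousOn (C γ₁) (Icc 0 1) := by
    let μ : Measure ℝ := (P.restrict {ω | U ω ≤ γ₁}).map V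
    have : NullSingletonClass μ := ⟨fun v => by
      rw [Measure.map_apply hV (measurableSet_singleton v)]
      exact le_antisymm ((Measure.restrict_apply_le _ _).trans (hVatomless v).le) bot_le⟩
    have hc : Continuous fun b => ∫ _ in (-1:ℝ)..b, (1:ℝ) ∂μ :=
      intervalIntegral.continuous_primitive (fun a b => intervalIntegrable_const) (-1)
    refine hc.continuousOn.congr ?_
    intro t ht
    have ht' : (-1:ℝ) ≤ t := by linarith [ht.1]
    simp only [intervalIntegral.integral_of_le ht']
    rw [hC, setIntegral_const, smul_eq_mul, mul_one, measureReal_def,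
      Measure.map_apply hV measurableSet_Ioc, Measure.restrict_apply (hV measurableSet_Ioc)]
    congr 2
    ext ω
    have := (hVrange ω).1
    simp only [mem_ofPred_eq, mem_inter_iff, mem_preimage, mem_Ioc]
    constructor
    · rintro ⟨a, b⟩
      exact ⟨⟨by linarith, b⟩, a⟩
    · rintro ⟨⟨_, b⟩, a⟩
      exact ⟨a, b⟩
  obtain ⟨s, hs, hsγ⟩ : γ ∈ C γ₁ '' Icc 0 1 :=
    intermediate_value_Icc zero_le_one hcont ⟨by rw [h0]; exact hγl, by rw [h1]; exact hγu.le⟩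
  have hclosed : IsClosed {t | t ∈ Icc (0:ℝ) 1 ∧ C γ₁ t ≤ γ} :=
    hcont.preimage_isClosed_of_isClosed isClosed_Icc isClosed_Iic
  have hbdd : BddAbove {t | t ∈ Icc (0:ℝ) 1 ∧ C γ₁ t ≤ γ} := ⟨1, fun t ht => ht.1.2⟩
  have hmem : tstar ∈ {t | t ∈ Icc (0:ℝ) 1 ∧ C γ₁ t ≤ γ} := by
    rw [htstar]
    exact hclosed.csSup_mem ⟨s, hs, hsγ.le⟩ hbdd
  have hub : ∀ t ∈ Icc (0:ℝ) 1, C γ₁ t ≤ γ → t ≤ tstar := by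
    intro t ht h
    rw [htstar]
    exact le_csSup hbdd ⟨ht, h⟩
  refine ⟨le_antisymm hmem.2 (hsγ ▸ hmono (hub s hs hsγ.le)), ?_⟩
  ext ω
  simp only [mem_ofPred_eq, mem_inter_iff, hW]
  split_ifs with h
  · exact ⟨fun h' => ⟨h, hub _ (hVrange ω) h'⟩, fun h' => (hmono h'.2).trans hmem.2⟩
  · exact ⟨fun h' => absurd (h'.trans hγu.le) h, fun h' => absurd h'.1 h⟩
end

section
/- Let ρ be a probability measure on α × ℝ (α a standard Borel measurable space) such that for ρ.fst-almost every a, the conditional CDF condCDF ρ a is a continuous function on ℝ. Then the pushforward of ρ under the map (a, x) ↦ condCDF ρ a x is the uniform distribution on [0,1]. (Theorem 2 of the paper: the two-stage FDR(S) aggregated p-value pˢ = C(p₂ | p₁), the conditional CDF of the primary p-value given the auxiliary p-value under the null joint distribution G₀, follows the uniform distribution on (0,1).) -/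
open MeasureTheory Set ProbabilityTheory

lemma aux_exists (F : StieltjesFunction ℝ) (hc : Continuous fun x => F x)
    (h0 : Filter.Tendsto F Filter.atBot (nhds 0)) (h1 : Filter.Tendsto F Filter.atTop (nhds 1))
    {u : ℝ} (hu0 : 0 < u) (hu1 : u < 1) : ∃ x, F x = u := by
  obtain ⟨a, ha⟩ := (h0.eventually (gt_mem_nhds hu0)).exists
  obtain ⟨b, hb⟩ := (h1.eventually (lt_mem_nhds hu1)).exists
  exact mem_range_of_exists_le_of_exists_ge hc ⟨a, ha.le⟩ ⟨b, hb.le⟩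

lemma aux_measure (F : StieltjesFunction ℝ) (hc : Continuous fun x => F x)
    (h0 : Filter.Tendsto F Filter.atBot (nhds 0)) (h1 : Filter.Tendsto F Filter.atTop (nhds 1))
    {t : ℝ} (ht0 : 0 ≤ t) (ht1 : t < 1) :
    F.measure {x | F x ≤ t} = ENNReal.ofReal t := by
  have hI : ∀ x, F.measure (Iic x) = ENNReal.ofReal (F x) := fun x => by
    rw [F.measure_Iic h0, sub_zero]
  apply le_antisymm
  · have hlim : Filter.Tendsto (fun u : ℝ => ENNReal.ofReal u) (nhdsWithin t (Ioi t))
        (nhds (ENNReal.ofReal t)) :=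
      (ENNReal.continuous_ofReal.tendsto t).mono_left nhdsWithin_le_nhds
    refine ge_of_tendsto hlim ?_
    filter_upwards [Ioo_mem_nhdsGT ht1] with u hu
    obtain ⟨y, hy⟩ := aux_exists F hc h0 h1 (ht0.trans_lt hu.1) hu.2
    rw [← hy, ← hI]
    refine measure_mono fun x hx => ?_
    by_contra hxy
    have h2 := F.mono (le_of_lt (not_le.1 hxy))
    have h3 : F x ≤ t := hx
    have := hu.1
    linarith
  · rcases ht0.eq_or_lt with h | h
    · simp [← h]
    · obtain ⟨y, hy⟩ := aux_exists F hc h0 h1 h ht1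
      rw [← hy, ← hI]
      exact measure_mono fun x hx => F.mono hx

lemma aux_measurable {α : Type*} [MeasurableSpace α] (ρ : Measure (α × ℝ)) :
    Measurable (fun p : α × ℝ => condCDF ρ p.1 p.2) := by
  refine measurable_of_Iio fun c => ?_
  have : (fun p : α × ℝ => condCDF ρ p.1 p.2) ⁻¹' Iio c
      = ⋃ q : ℚ, {a | condCDF ρ a q < c} ×ˢ Iio (q : ℝ) := by
    ext ⟨a, x⟩
    simp only [mem_preimage, mem_Iio, mem_iUnion, mem_prod, mem_ofPred_eq]
    constructor
    · intro h
      rw [← StieltjesFunction.iInf_rat_gt_eq] at h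
      have : Nonempty { r' : ℚ // x < r' } := by
        obtain ⟨q, hq⟩ := exists_rat_gt x
        exact ⟨⟨q, hq⟩⟩
      obtain ⟨q, hq⟩ := exists_lt_of_ciInf_lt h
      exact ⟨q.1, hq, q.2⟩
    · rintro ⟨q, hq, hx⟩
      exact ((condCDF ρ a).mono hx.le).trans_lt hq
  rw [this]
  exact MeasurableSet.iUnion fun q =>
    (measurableSet_lt (measurable_condCDF ρ q) measurable_const).prod measurableSet_Iio

/-- Theorem 2 of the paper: if for `ρ.fst`-almost every `a` the conditional CDF
`condCDF ρ a` is continuous, then the two-stage FDR(S) aggregated p-value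
`pˢ(a, x) = condCDF ρ a x` is uniformly distributed on `[0,1]`: the pushforward of
`ρ` under `(a, x) ↦ condCDF ρ a x` is Lebesgue measure restricted to `[0,1]`. -/
theorem two_stage_FDR_S_uniform
    {α : Type*} [MeasurableSpace α] [StandardBorelSpace α]
    (ρ : Measure (α × ℝ)) [IsProbabilityMeasure ρ]
    (hcont : ∀ᵐ a ∂ρ.fst, Continuous fun x => condCDF ρ a x) :
    Measure.map (fun p : α × ℝ => condCDF ρ p.1 p.2) ρ
      = volume.restrict (Icc (0:ℝ) 1) := by
  have hm := aux_measurable ρ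
  have : IsProbabilityMeasure (Measure.map (fun p : α × ℝ => condCDF ρ p.1 p.2) ρ) :=
    Measure.isProbabilityMeasure_map hm.aemeasurable
  refine Measure.ext_of_Iic _ _ fun t => ?_
  rw [Measure.map_apply hm measurableSet_Iic, Measure.restrict_apply measurableSet_Iic]
  rcases lt_or_ge t 0 with h | h
  · have e1 : (fun p : α × ℝ => condCDF ρ p.1 p.2) ⁻¹' Iic t = ∅ := by
      ext p
      simpa using h.trans_le (condCDF_nonneg ρ p.1 p.2)
    have e2 : Iic t ∩ Icc (0:ℝ) 1 = ∅ := by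
      ext x
      simp only [mem_inter_iff, mem_Iic, mem_Icc, mem_empty_iff_false, iff_false]
      intro hx
      linarith [hx.1, hx.2.1]
    rw [e1, e2]; simp
  rcases lt_or_ge t 1 with h' | h'
  · have e2 : Iic t ∩ Icc (0:ℝ) 1 = Icc 0 t := by
      ext x
      simp only [mem_inter_iff, mem_Iic, mem_Icc]
      constructor
      · intro hx; exact ⟨hx.2.1, hx.1⟩
      · intro hx; exact ⟨hx.2, hx.1, hx.2.trans h'.le⟩
    have key := lintegral_toKernel_mem (isCondKernelCDF_condCDF ρ) () (hm (measurableSet_Iic (a := t)))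
    simp only [Kernel.const_apply, IsCondKernelCDF.toKernel_apply] at key
    rw [e2, Real.volume_Icc, sub_zero, ← key]
    have : ∀ᵐ a ∂ρ.fst, (condCDF ρ a).measure
        (Prod.mk a ⁻¹' ((fun p : α × ℝ => condCDF ρ p.1 p.2) ⁻¹' Iic t)) = ENNReal.ofReal t := by
      filter_upwards [hcont] with a ha
      exact aux_measure _ ha (tendsto_condCDF_atBot ρ a) (tendsto_condCDF_atTop ρ a) h h'
    rw [lintegral_congr_ae this]
    simp
  · have e1 : (fun p : α × ℝ => condCDF ρ p.1 p.2) ⁻¹' Iic t = univ := by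
      ext p
      simpa using (condCDF_le_one ρ p.1 p.2).trans h'
    have e2 : Iic t ∩ Icc (0:ℝ) 1 = Icc 0 1 :=
      inter_eq_right.2 fun x hx => hx.2.trans h'
    rw [e1, e2]; simp
end

section
/- Let ρ be a probability measure on α × ℝ (α a standard Borel measurable space) such that for ρ.fst-almost every a, the conditional CDF condCDF ρ a is a continuous function on ℝ. Then for ρ.fst-almost every a, the pushforward of the disintegration kernel ρ.condKernel a under the map x ↦ condCDF ρ a x is the uniform distribution on [0,1]. (Conditional-uniformity step in the proof of Theorem 2: given the auxiliary p-value p₁ = a, the transformed primary p-value pˢ = condCDF ρ a (p₂) is conditionally uniform.) -/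
open MeasureTheory Set ProbabilityTheory

lemma stieltjes_map_uniform (F : StieltjesFunction ℝ) (h0 : ∀ x, 0 ≤ F x) (h1 : ∀ x, F x ≤ 1)
    (hb : Filter.Tendsto F Filter.atBot (nhds 0)) (ht : Filter.Tendsto F Filter.atTop (nhds 1))
    (hc : Continuous fun x => F x) :
    Measure.map (fun x => F x) F.measure = volume.restrict (Icc (0:ℝ) 1) := by
  have hp : IsProbabilityMeasure F.measure :=
    ⟨by rw [F.measure_univ hb ht, sub_zero, ENNReal.ofReal_one]⟩
  have : IsFiniteMeasure (Measure.map (fun x => F x) F.measure) := inferInstance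
  refine Measure.ext_of_Iic _ _ fun t => ?_
  rw [Measure.map_apply hc.measurable measurableSet_Iic, Measure.restrict_apply measurableSet_Iic]
  rcases lt_or_ge t 0 with h | h
  · have e1 : (fun x => F x) ⁻¹' Iic t = ∅ := by
      ext x
      have := h0 x
      simp only [mem_preimage, mem_Iic, mem_empty_iff_false, iff_false]
      linarith
    have e2 : Iic t ∩ Icc (0:ℝ) 1 = ∅ := by
      ext x
      simp only [mem_inter_iff, mem_Iic, mem_Icc, mem_empty_iff_false, iff_false]
      rintro ⟨a, b, c⟩
      linarith
    rw [e1, e2]; simp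
  rcases le_or_gt 1 t with h' | h'
  · have e1 : (fun x => F x) ⁻¹' Iic t = univ := by
      ext x
      simpa using (h1 x).trans h'
    have e2 : Iic t ∩ Icc (0:ℝ) 1 = Icc 0 1 := by
      ext x
      simp only [mem_inter_iff, mem_Iic, mem_Icc]
      exact ⟨fun a => a.2, fun a => ⟨a.2.trans h', a⟩⟩
    rw [e1, e2]; simp
  have e2 : Iic t ∩ Icc (0:ℝ) 1 = Icc 0 t := by
    ext x
    simp only [mem_inter_iff, mem_Iic, mem_Icc]
    exact ⟨fun a => ⟨a.2.1, a.1⟩, fun a => ⟨a.2, a.1, a.2.trans h'.le⟩⟩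
  rw [e2, Real.volume_Icc, sub_zero]
  set S := (fun x => F x) ⁻¹' Iic t with hS
  rcases S.eq_empty_or_nonempty with he | hne
  · have : t ≤ 0 := by
      by_contra! hlt
      obtain ⟨x, hx⟩ := (hb.eventually (gt_mem_nhds hlt)).exists
      have : x ∈ S := le_of_lt hx
      simp [he] at this
    rw [he, measure_empty, ENNReal.ofReal_of_nonpos this]
  have hbd : BddAbove S := by
    obtain ⟨y, hy⟩ := (ht.eventually (lt_mem_nhds h')).exists
    refine ⟨y, fun x hx => ?_⟩
    by_contra! hlt
    exact absurd (F.mono hlt.le) (not_le.2 (lt_of_le_of_lt hx hy))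
  have hz : sSup S ∈ S := (isClosed_Iic.preimage hc).csSup_mem hne hbd
  have hSI : S = Iic (sSup S) := by
    ext x
    exact ⟨fun hx => le_csSup hbd hx, fun hx => (F.mono hx).trans hz⟩
  have hFz : F (sSup S) = t := by
    refine le_antisymm hz ?_
    by_contra! hlt
    have hev := hc.continuousAt.eventually (gt_mem_nhds hlt)
    obtain ⟨x, hx1, hx2⟩ := ((hev.filter_mono (nhdsWithin_le_nhds (s := Ioi (sSup S)))).and
      self_mem_nhdsWithin).exists
    exact absurd (le_csSup hbd (show x ∈ S from le_of_lt hx1)) (not_le.2 hx2)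
  rw [hSI, F.measure_Iic hb, sub_zero, hFz]

/-- Conditional-uniformity step in the proof of Theorem 2: if for `ρ.fst`-almost
every `a` the conditional CDF `condCDF ρ a` is continuous, then for `ρ.fst`-almost
every `a` the pushforward of the disintegration kernel `ρ.condKernel a` under
`x ↦ condCDF ρ a x` is the uniform distribution on `[0,1]`. -/
theorem two_stage_FDR_S_conditionally_uniform
    {α : Type*} [MeasurableSpace α] [StandardBorelSpace α]
    (ρ : Measure (α × ℝ)) [IsProbabilityMeasure ρ]
    (hcont : ∀ᵐ a ∂ρ.fst, Continuous fun x => condCDF ρ a x) :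
    ∀ᵐ a ∂ρ.fst,
      Measure.map (fun x => condCDF ρ a x) (ρ.condKernel a)
        = volume.restrict (Icc (0:ℝ) 1) := by
  have key : ∀ᵐ a ∂ρ.fst, (condCDF ρ a).measure = ρ.condKernel a := by
    let κ : Kernel α ℝ := ⟨fun a => (condCDF ρ a).measure, measurable_measure_condCDF ρ⟩
    have hκ : IsMarkovKernel κ := ⟨fun a => ⟨measure_condCDF_univ ρ a⟩⟩
    have hk : ∀ q : ℚ, ∀ᵐ a ∂ρ.fst, κ a (Iic (q:ℝ)) = ρ.condKernel a (Iic (q:ℝ)) := by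
      intro q
      refine ae_eq_of_forall_setLIntegral_eq_of_sigmaFinite
        (Kernel.measurable_coe _ measurableSet_Iic) (Kernel.measurable_coe _ measurableSet_Iic) ?_
      intro s hs _
      have e1 : ∀ a, κ a (Iic (q:ℝ)) = ENNReal.ofReal (condCDF ρ a q) :=
        fun a => measure_condCDF_Iic ρ a q
      simp_rw [e1]
      rw [setLIntegral_condCDF ρ q hs]
      conv_lhs => rw [← ρ.disintegrate ρ.condKernel]
      rw [Measure.compProd_apply_prod hs measurableSet_Iic]
    filter_upwards [ae_all_iff.2 hk] with a ha
    refine ext_of_generate_finite _ Real.borel_eq_generateFrom_Iic_rat Real.isPiSystem_Iic_rat ?_ ?_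
    · rintro _ hs
      simp only [mem_iUnion, mem_singleton_iff] at hs
      obtain ⟨q, rfl⟩ := hs
      exact ha q
    · simp [measure_condCDF_univ]
  filter_upwards [hcont, key] with a ha hk
  rw [← hk]
  exact stieltjes_map_uniform _ (condCDF_nonneg ρ a) (condCDF_le_one ρ a)
    (tendsto_condCDF_atBot ρ a) (tendsto_condCDF_atTop ρ a) ha
end

section
/- Let ρ be a probability measure on α × ℝ (α a standard Borel measurable space) such that for ρ.fst-almost every a, the conditional CDF condCDF ρ a is a continuous function on ℝ. Then for every measurable set A ⊆ α and every γ ∈ [0,1], ρ({(a, x) : a ∈ A and condCDF ρ a x ≤ γ}) = γ · ρ.fst(A). In particular, the two-stage FDR(S) aggregated p-value pˢ(a, x) = condCDF ρ a x is uniformly distributed on [0,1] and independent of the first coordinate (the auxiliary variable). -/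
open MeasureTheory Set ProbabilityTheory

theorem aux_oneDim (F : StieltjesFunction ℝ) (hF : Continuous fun x => F x)
    (h0 : Filter.Tendsto F Filter.atBot (nhds 0)) (h1 : Filter.Tendsto F Filter.atTop (nhds 1))
    (hle : ∀ x, F x ≤ 1) (γ : ℝ) (hγ : γ ∈ Icc (0:ℝ) 1) :
    F.measure {x | F x ≤ γ} = ENNReal.ofReal γ := by
  rcases eq_or_lt_of_le hγ.2 with rfl | hlt
  · have : {x | F x ≤ 1} = univ := by ext x; simp [hle x]
    rw [this, F.measure_univ h0 h1]; simp
  rcases eq_empty_or_nonempty {x | F x ≤ γ} with he | hne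
  · have : γ ≤ 0 := by
      refine ge_of_tendsto h0 (Filter.Eventually.of_forall fun x => ?_)
      by_contra hx
      have : x ∈ {x | F x ≤ γ} := (not_le.1 hx).le
      rw [he] at this
      exact this
    rw [he, ENNReal.ofReal_of_nonpos this]; simp
  have hcl : IsClosed {x | F x ≤ γ} := isClosed_le hF continuous_const
  have hbdd : BddAbove {x | F x ≤ γ} := by
    obtain ⟨b, hb⟩ := (h1.eventually (lt_mem_nhds hlt)).exists
    refine ⟨b, fun x hx => ?_⟩
    by_contra hxb
    exact absurd (F.mono (not_le.1 hxb).le) (not_le.2 (lt_of_le_of_lt hx hb))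
  have hmem := hcl.csSup_mem hne hbdd
  set x0 := sSup {x | F x ≤ γ} with hx0
  have hS : {x | F x ≤ γ} = Iic x0 := by
    ext x
    exact ⟨fun hx => le_csSup hbdd hx, fun hx => (F.mono hx).trans hmem⟩
  have hx0γ : F x0 = γ := by
    refine le_antisymm hmem ?_
    have ht : Filter.Tendsto (fun x => F x) (nhdsWithin x0 (Ioi x0)) (nhds (F x0)) :=
      hF.continuousAt.tendsto.mono_left nhdsWithin_le_nhds
    refine ge_of_tendsto ht ?_
    filter_upwards [self_mem_nhdsWithin] with y hy
    by_contra hc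
    have : y ∈ {x | F x ≤ γ} := (not_le.1 hc).le
    rw [hS] at this
    exact absurd (mem_Iic.1 this) (not_le.2 (mem_Ioi.1 hy))
  rw [hS, F.measure_Iic h0, hx0γ, sub_zero]

theorem aux_meas {α : Type*} [MeasurableSpace α] (ρ : Measure (α × ℝ)) :
    Measurable fun p : α × ℝ => condCDF ρ p.1 p.2 := by
  refine measurable_of_Iio fun c => ?_
  have : (fun p : α × ℝ => condCDF ρ p.1 p.2) ⁻¹' Iio c
      = ⋃ q : ℚ, {p : α × ℝ | condCDF ρ p.1 q < c ∧ p.2 < q} := by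
    ext p
    simp only [mem_preimage, mem_Iio, mem_iUnion, mem_ofPred_eq]
    constructor
    · intro h
      have hr := ((condCDF ρ p.1).right_continuous p.2).mono Ioi_subset_Ici_self
      have h2 := hr.tendsto.eventually (gt_mem_nhds h)
      obtain ⟨u, hu, hu2⟩ := mem_nhdsGT_iff_exists_Ioo_subset.1 h2
      obtain ⟨q, hq1, hq2⟩ := exists_rat_btwn (mem_Ioi.1 hu)
      exact ⟨q, hu2 ⟨hq1, hq2⟩, hq1⟩
    · rintro ⟨q, h, hq⟩
      exact lt_of_le_of_lt ((condCDF ρ p.1).mono hq.le) h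
  rw [this]
  refine MeasurableSet.iUnion fun q => ?_
  exact (measurableSet_lt ((measurable_condCDF ρ q).comp measurable_fst) measurable_const).inter
    (measurableSet_lt measurable_snd measurable_const)

/-- If for `ρ.fst`-almost every `a` the conditional CDF `condCDF ρ a` is continuous,
then for every measurable `A ⊆ α` and every `γ ∈ [0,1]`,
`ρ({(a, x) : a ∈ A ∧ condCDF ρ a x ≤ γ}) = γ · ρ.fst(A)`; in particular the
two-stage FDR(S) aggregated p-value is uniform on `[0,1]` and independent of the
auxiliary variable. -/
theorem two_stage_FDR_S_uniform_and_independent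
    {α : Type*} [MeasurableSpace α] [StandardBorelSpace α]
    (ρ : Measure (α × ℝ)) [IsProbabilityMeasure ρ]
    (hcont : ∀ᵐ a ∂ρ.fst, Continuous fun x => condCDF ρ a x) :
    ∀ A : Set α, MeasurableSet A → ∀ γ ∈ Icc (0:ℝ) 1,
      (ρ {p : α × ℝ | p.1 ∈ A ∧ condCDF ρ p.1 p.2 ≤ γ}).toReal
        = γ * (ρ.fst A).toReal := by
  intro A hA γ hγ
  have hms : MeasurableSet {p : α × ℝ | p.1 ∈ A ∧ condCDF ρ p.1 p.2 ≤ γ} :=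
    (measurable_fst hA).inter (measurableSet_le (aux_meas ρ) measurable_const)
  have key := lintegral_toKernel_mem (isCondKernelCDF_condCDF ρ) () hms
  simp only [Kernel.const_apply, IsCondKernelCDF.toKernel_apply] at key
  have h2 : ∫⁻ b, (condCDF ρ b).measure
        (Prod.mk b ⁻¹' {p : α × ℝ | p.1 ∈ A ∧ condCDF ρ p.1 p.2 ≤ γ}) ∂ρ.fst
      = ∫⁻ b, A.indicator (fun _ => ENNReal.ofReal γ) b ∂ρ.fst := by
    refine lintegral_congr_ae ?_
    filter_upwards [hcont] with a ha
    by_cases haA : a ∈ A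
    · simp only [haA, indicator_of_mem, preimage_ofPred_eq, true_and]
      exact aux_oneDim _ ha (tendsto_condCDF_atBot ρ a) (tendsto_condCDF_atTop ρ a)
        (condCDF_le_one ρ a) γ hγ
    · simp [haA]
  have h3 := key.symm.trans h2
  rw [h3, lintegral_indicator_const hA, ENNReal.toReal_mul, ENNReal.toReal_ofReal hγ.1]
end
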